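/- The set of two-sided ideals of the algebra S_n satisfies the ascending chain condition: every ascending chain of two-sided ideals of S_n stabilizes. -/

import Mathlib

set_option synthInstance.maxHeartbeats 1000000
set_option maxHeartbeats 1000000

open MvPolynomial

noncomputable section

/-- The polynomial algebra `P_n = K[x_1, …, x_n]`. -/
abbrev PolyAlg (K : Type u) [Field K] (n : ℕ) := MvPolynomial (Fin n) K

/-- `X_i` : multiplication by the variable `x_i`, as a `K`-linear endomorphism of `P_n`. -/
def Xop (K : Type u) [Field K] (n : ℕ) (i : Fin n) : Module.End K (PolyAlg K n) :=
  LinearMap.mulLeft K (X i)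

/-- `Y_i` : the left inverse of `X_i`, sending a monomial `x^α` to `x^{α - e_i}` if `α i ≥ 1`
and to `0` otherwise. -/
def Yop (K : Type u) [Field K] (n : ℕ) (i : Fin n) : Module.End K (PolyAlg K n) :=
  (basisMonomials (Fin n) K).constr K fun α =>
    if α i = 0 then 0 else monomial (α - Finsupp.single i 1) (1 : K)

/-- The algebra `S_n` of one-sided inverses of `P_n` : the subalgebra of `End_K(P_n)`
generated by `X_1, …, X_n, Y_1, …, Y_n`. -/
def SnAlg (K : Type u) [Field K] (n : ℕ) : Subalgebra K (Module.End K (PolyAlg K n)) :=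
  Algebra.adjoin K (Set.range (Xop K n) ∪ Set.range (Yop K n))

/-- `x_i` as an element of `S_n`. -/
def xS (K : Type u) [Field K] (n : ℕ) (i : Fin n) : SnAlg K n :=
  ⟨Xop K n i, Algebra.subset_adjoin (Set.mem_union_left _ ⟨i, rfl⟩)⟩

/-- `y_i` as an element of `S_n`. -/
def yS (K : Type u) [Field K] (n : ℕ) (i : Fin n) : SnAlg K n :=
  ⟨Yop K n i, Algebra.subset_adjoin (Set.mem_union_right _ ⟨i, rfl⟩)⟩

/-- The product `I*J` of two two-sided ideals: the two-sided ideal generated by all products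
`a * b` with `a ∈ I`, `b ∈ J`. -/
def tsiMul {R : Type*} [Ring R] (I J : TwoSidedIdeal R) : TwoSidedIdeal R :=
  TwoSidedIdeal.span {x | ∃ a ∈ I, ∃ b ∈ J, x = a * b}

/-- A two-sided ideal `P` of a ring is prime if it is proper and for all two-sided ideals
`I`, `J`, `I*J ⊆ P` implies `I ⊆ P` or `J ⊆ P`. -/
def tsiPrime {R : Type*} [Ring R] (P : TwoSidedIdeal R) : Prop :=
  P ≠ ⊤ ∧ ∀ I J : TwoSidedIdeal R, tsiMul I J ≤ P → I ≤ P ∨ J ≤ P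

section OneSidedInverse

variable {K : Type*} {R : Type*} [Field K] [Ring R] [Algebra K R]

/-- The elements annihilated by a power of `y` on the left and by a power of `x` on the right
form a two-sided ideal as soon as `R` is generated by `x`, its left inverse `y`, and elements
commuting with both. -/
theorem exists_pow_mul_eq_zero_of_mem_span {x y : R} {A : Subalgebra K R} (hyx : y * x = 1)
    (hAx : ∀ a ∈ A, Commute a x) (hAy : ∀ a ∈ A, Commute a y)
    (hgen : Algebra.adjoin K ((A : Set R) ∪ {x, y}) = ⊤) {d : R}
    (hd : d ∈ TwoSidedIdeal.span {1 - x * y}) :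
    ∃ M : ℕ, y ^ M * d = 0 ∧ d * x ^ M = 0 := by
  have hl : ∀ {d : R} {M N : ℕ}, M ≤ N → y ^ M * d = 0 → y ^ N * d = 0 := by
    intro d M N h hd
    obtain ⟨k, rfl⟩ := Nat.exists_eq_add_of_le' h
    rw [pow_add, mul_assoc, hd, mul_zero]
  have hr : ∀ {d : R} {M N : ℕ}, M ≤ N → d * x ^ M = 0 → d * x ^ N = 0 := by
    intro d M N h hd
    obtain ⟨k, rfl⟩ := Nat.exists_eq_add_of_le h
    rw [pow_add, ← mul_assoc, hd, zero_mul]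
  have hleft : ∀ r : R, ∀ d : R, (∃ M : ℕ, y ^ M * d = 0) → ∃ M : ℕ, y ^ M * (r * d) = 0 := by
    intro r
    have hr' : r ∈ Algebra.adjoin K ((A : Set R) ∪ {x, y}) := hgen ▸ Algebra.mem_top
    induction hr' using Algebra.adjoin_induction with
    | mem r h =>
      rintro d ⟨M, hM⟩
      rcases h with h | rfl | rfl
      · exact ⟨M, by rw [← mul_assoc, ← ((hAy r h).pow_right M).eq, mul_assoc, hM, mul_zero]⟩
      · exact ⟨M + 1, by rw [pow_succ, mul_assoc, ← mul_assoc y, hyx, one_mul, hM]⟩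
      · exact ⟨M, by rw [← mul_assoc, ← pow_succ, pow_succ', mul_assoc, hM, mul_zero]⟩
    | algebraMap r =>
      rintro d ⟨M, hM⟩
      exact ⟨M, by rw [← mul_assoc, ← Algebra.commutes, mul_assoc, hM, mul_zero]⟩
    | add r s _ _ h₁ h₂ =>
      intro d hd
      obtain ⟨M, hM⟩ := h₁ d hd
      obtain ⟨N, hN⟩ := h₂ d hd
      exact ⟨max M N, by
        rw [add_mul, mul_add, hl (le_max_left M N) hM, hl (le_max_right M N) hN, add_zero]⟩
    | mul r s _ _ h₁ h₂ =>
      intro d hd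
      simpa only [mul_assoc] using h₁ _ (h₂ d hd)
  have hright : ∀ r : R, ∀ d : R, (∃ M : ℕ, d * x ^ M = 0) → ∃ M : ℕ, d * r * x ^ M = 0 := by
    intro r
    have hr' : r ∈ Algebra.adjoin K ((A : Set R) ∪ {x, y}) := hgen ▸ Algebra.mem_top
    induction hr' using Algebra.adjoin_induction with
    | mem r h =>
      rintro d ⟨M, hM⟩
      rcases h with h | rfl | rfl
      · exact ⟨M, by rw [mul_assoc, ((hAx r h).pow_right M).eq, ← mul_assoc, hM, zero_mul]⟩
      · exact ⟨M, by rw [mul_assoc, ← pow_succ', pow_succ, ← mul_assoc, hM, zero_mul]⟩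
      · exact ⟨M + 1, by rw [pow_succ', mul_assoc, ← mul_assoc _ x, hyx, one_mul, hM]⟩
    | algebraMap r =>
      rintro d ⟨M, hM⟩
      exact ⟨M, by rw [mul_assoc, Algebra.commutes, ← mul_assoc, hM, zero_mul]⟩
    | add r s _ _ h₁ h₂ =>
      intro d hd
      obtain ⟨M, hM⟩ := h₁ d hd
      obtain ⟨N, hN⟩ := h₂ d hd
      exact ⟨max M N, by
        rw [mul_add, add_mul, hr (le_max_left M N) hM, hr (le_max_right M N) hN, add_zero]⟩
    | mul r s _ _ h₁ h₂ =>
      intro d hd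
      simpa only [mul_assoc] using h₂ _ (h₁ d hd)
  let V : TwoSidedIdeal R := .mk' {d | (∃ M : ℕ, y ^ M * d = 0) ∧ ∃ M : ℕ, d * x ^ M = 0}
    ⟨⟨0, by simp⟩, ⟨0, by simp⟩⟩
    (by
      rintro a b ⟨⟨M, hM⟩, N, hN⟩ ⟨⟨M', hM'⟩, N', hN'⟩
      exact ⟨⟨max M M', by
          rw [mul_add, hl (le_max_left M M') hM, hl (le_max_right M M') hM', add_zero]⟩,
        max N N', by
          rw [add_mul, hr (le_max_left N N') hN, hr (le_max_right N N') hN', add_zero]⟩)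
    (by
      rintro a ⟨⟨M, hM⟩, N, hN⟩
      exact ⟨⟨M, by rw [mul_neg, hM, neg_zero]⟩, N, by rw [neg_mul, hN, neg_zero]⟩)
    (by
      rintro r d ⟨h₁, N, hN⟩
      exact ⟨hleft r d h₁, N, by rw [mul_assoc, hN, mul_zero]⟩)
    (by
      rintro d r ⟨⟨M, hM⟩, h₂⟩
      exact ⟨⟨M, by rw [← mul_assoc, hM, zero_mul]⟩, hright r d h₂⟩)
  have hV : TwoSidedIdeal.span {1 - x * y} ≤ V := by
    rw [TwoSidedIdeal.span_le, Set.singleton_subset_iff, SetLike.mem_coe, TwoSidedIdeal.mem_mk']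
    exact ⟨⟨1, by rw [pow_one, mul_sub, ← mul_assoc, hyx, one_mul, mul_one, sub_self]⟩,
      1, by rw [pow_one, sub_mul, mul_assoc, hyx, one_mul, mul_one, sub_self]⟩
  obtain ⟨⟨M, hM⟩, N, hN⟩ := (TwoSidedIdeal.mem_mk' _ _ _ _ _ _ _).1 (hV hd)
  exact ⟨max M N, hl (le_max_left M N) hM, hr (le_max_right M N) hN⟩

/-- The corner of `R` at the idempotent `1 - x * y` consists of multiples of the idempotent by
elements of `A`. -/
theorem exists_corner_eq {x y : R} {A : Subalgebra K R} (hyx : y * x = 1)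
    (hAx : ∀ a ∈ A, Commute a x) (hAy : ∀ a ∈ A, Commute a y)
    (hgen : Algebra.adjoin K ((A : Set R) ∪ {x, y}) = ⊤) (r : R) (j : ℕ) :
    ∃ a ∈ A, (1 - x * y) * y ^ j * r * (1 - x * y) = a * (1 - x * y) := by
  have hex : (1 - x * y) * x = 0 := by
    rw [sub_mul, mul_assoc, hyx, one_mul, mul_one, sub_self]
  have hye : y * (1 - x * y) = 0 := by
    rw [mul_sub, ← mul_assoc, hyx, one_mul, mul_one, sub_self]
  have hAe : ∀ a ∈ A, Commute a (1 - x * y) := fun a ha =>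
    (Commute.one_right a).sub_right ((hAx a ha).mul_right (hAy a ha))
  set e := 1 - x * y with he
  have hee : e * e = e := by
    nth_rewrite 1 [he]
    rw [sub_mul, mul_assoc, hye, mul_zero, one_mul, sub_zero]
  have key : ∀ r s : R, (∀ j : ℕ, ∃ a ∈ A, e * y ^ j * s * e = a * e) →
      ∀ j : ℕ, ∃ a ∈ A, e * y ^ j * (r * s) * e = a * e := by
    intro r
    have hr' : r ∈ Algebra.adjoin K ((A : Set R) ∪ {x, y}) := hgen ▸ Algebra.mem_top
    have hA : ∀ b ∈ A, ∀ s : R, (∀ j : ℕ, ∃ a ∈ A, e * y ^ j * s * e = a * e) →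
      ∀ j : ℕ, ∃ a ∈ A, e * y ^ j * (b * s) * e = a * e := by
      intro b hb s hs j
      obtain ⟨a, ha, h⟩ := hs j
      refine ⟨b * a, mul_mem hb ha, ?_⟩
      have hc : Commute b (e * y ^ j) := (hAe b hb).mul_right ((hAy b hb).pow_right j)
      rw [← mul_assoc, ← hc.eq, mul_assoc b, mul_assoc b, h, mul_assoc]
    induction hr' using Algebra.adjoin_induction with
    | mem r h =>
      rcases h with h | rfl | rfl
      · exact hA r h
      · intro s hs j
        cases j with
        | zero =>
          exact ⟨0, zero_mem A, by rw [pow_zero, mul_one, ← mul_assoc, hex, zero_mul, zero_mul]⟩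
        | succ j =>
          obtain ⟨a, ha, h⟩ := hs j
          refine ⟨a, ha, ?_⟩
          have h' : y ^ (j + 1) * (r * s) = y ^ j * s := by
            rw [pow_succ, mul_assoc, ← mul_assoc y, hyx, one_mul]
          rw [← h, mul_assoc e, h', ← mul_assoc e]
      · intro s hs j
        obtain ⟨a, ha, h⟩ := hs (j + 1)
        exact ⟨a, ha, by rw [← h, pow_succ]; simp only [mul_assoc]⟩
    | algebraMap r => exact hA _ (A.algebraMap_mem r)
    | add r r' _ _ h₁ h₂ =>
      intro s hs j
      obtain ⟨a, ha, h⟩ := h₁ s hs j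
      obtain ⟨b, hb, h'⟩ := h₂ s hs j
      exact ⟨a + b, add_mem ha hb, by rw [add_mul, mul_add, add_mul, h, h', add_mul]⟩
    | mul r r' _ _ h₁ h₂ =>
      intro s hs
      simpa only [mul_assoc] using h₁ _ (h₂ s hs)
  rw [← mul_one r]
  refine key r 1 (fun j => ?_) j
  cases j with
  | zero => exact ⟨1, one_mem A, by rw [pow_zero, mul_one, mul_one, hee, one_mul]⟩
  | succ j =>
    exact ⟨0, zero_mem A, by rw [mul_one, pow_succ, mul_assoc, mul_assoc, hye]; simp⟩

/-- An ideal is detected by its image modulo `1 - x * y` and by its trace on the corner at this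
idempotent. -/
theorem TwoSidedIdeal.le_of_le_sup_span_of_corner {x y : R} {A : Subalgebra K R}
    (hyx : y * x = 1) (hAx : ∀ a ∈ A, Commute a x) (hAy : ∀ a ∈ A, Commute a y)
    (hgen : Algebra.adjoin K ((A : Set R) ∪ {x, y}) = ⊤) {I J : TwoSidedIdeal R}
    (hIJ : I ≤ J) (hsup : J ≤ I ⊔ TwoSidedIdeal.span {1 - x * y})
    (hcorner : ∀ a ∈ A, a * (1 - x * y) ∈ J → a * (1 - x * y) ∈ I) : J ≤ I := by
  intro b hb
  obtain ⟨c, hc, d, hd, rfl⟩ := TwoSidedIdeal.mem_sup.1 (hsup hb)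
  refine I.add_mem hc ?_
  have hdJ : d ∈ J := by simpa using J.sub_mem hb (hIJ hc)
  obtain ⟨M, hM, hM'⟩ := exists_pow_mul_eq_zero_of_mem_span hyx hAx hAy hgen hd
  set e := 1 - x * y with he
  have hone : (1 : R) = e + x * y := by rw [he, sub_add_cancel]
  have hmid : ∀ j k : ℕ, e * y ^ j * (d * x ^ k) * e ∈ I := by
    intro j k
    obtain ⟨a, ha, h⟩ := exists_corner_eq hyx hAx hAy hgen (d * x ^ k) j
    rw [h]
    refine hcorner a ha ?_
    rw [← h]
    exact J.mul_mem_right _ _ (J.mul_mem_left _ _ (J.mul_mem_right _ _ hdJ))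
  have hleft : ∀ k : ℕ, d * x ^ k * e ∈ I := by
    intro k
    have : ∀ j : ℕ, y ^ j * (d * x ^ k * e) ∈ I → d * x ^ k * e ∈ I := by
      intro j
      induction j with
      | zero => intro h; simpa using h
      | succ j ih =>
        intro h
        refine ih ?_
        have h' : y ^ j * (d * x ^ k * e) =
            e * y ^ j * (d * x ^ k) * e + x * (y ^ (j + 1) * (d * x ^ k * e)) := by
          rw [← one_mul (y ^ j * (d * x ^ k * e)), hone, add_mul, pow_succ']
          simp only [mul_assoc]
        rw [h']
        exact I.add_mem (hmid j k) (I.mul_mem_left _ _ h)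
    refine this M ?_
    rw [← mul_assoc, ← mul_assoc, hM, zero_mul, zero_mul]
    exact I.zero_mem
  have : ∀ k : ℕ, d * x ^ k ∈ I → d ∈ I := by
    intro k
    induction k with
    | zero => intro h; simpa using h
    | succ k ih =>
      intro h
      refine ih ?_
      have h' : d * x ^ k = d * x ^ k * e + d * x ^ (k + 1) * y := by
        rw [pow_succ, mul_assoc d (x ^ k * x), mul_assoc (x ^ k), ← mul_assoc d, ← mul_add,
          ← hone, mul_one]
      rw [h']
      exact I.add_mem (hleft k) (I.mul_mem_right _ _ h)
  exact this M (hM' ▸ I.zero_mem)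

/-- Ascending chains of ideals stabilize if the quotient by the first one is a finitely
generated commutative algebra. -/
theorem TwoSidedIdeal.monotone_stabilizes_of_commute_mod {s : Set R} (hs : s.Finite)
    (hgen : Algebra.adjoin K s = ⊤) {f : ℕ → TwoSidedIdeal R} (hf : Monotone f)
    (hcomm : ∀ a ∈ s, ∀ b ∈ s, a * b - b * a ∈ f 0) : ∃ N, ∀ m, N ≤ m → f m = f N := by
  let Q := (f 0).ringCon.Quotient
  let π : R →ₐ[K] Q := { (f 0).ringCon.mk' with commutes' := fun _ => rfl }
  have hπ : Function.Surjective π := (f 0).ringCon.mk'_surjective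
  have hker : ∀ a b : R, π a = π b ↔ a - b ∈ f 0 := fun a b =>
    ((f 0).ringCon.eq).trans ((f 0).rel_iff a b)
  have hQ : Algebra.adjoin K (π '' s) = ⊤ := by
    rw [Algebra.adjoin_image, hgen, Algebra.map_top, AlgHom.range_eq_top]
    exact hπ
  have hmul : ∀ a b : Q, a * b = b * a := by
    intro a b
    refine Algebra.commute_of_mem_adjoin_of_forall_mem_commute (R := K) (s := π '' s)
      (hQ ▸ Algebra.mem_top) ?_
    rintro _ ⟨b, hb, rfl⟩
    refine (Algebra.commute_of_mem_adjoin_of_forall_mem_commute (R := K) (s := π '' s)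
      (hQ ▸ Algebra.mem_top) ?_).symm
    rintro _ ⟨a, ha, rfl⟩
    rw [commute_iff_eq, ← map_mul, ← map_mul, hker]
    exact hcomm b hb a ha
  let : CommRing Q := { (inferInstance : Ring Q) with mul_comm := hmul }
  have : Algebra.FiniteType K Q := ⟨⟨(hs.image π).toFinset, by simpa using hQ⟩⟩
  have hN : IsNoetherianRing Q := Algebra.FiniteType.isNoetherianRing K Q
  let g : ℕ →o Ideal Q :=
    ⟨fun m => (TwoSidedIdeal.asIdeal (f m)).map π, fun a b h => Ideal.map_mono (hf h)⟩
  obtain ⟨N, h⟩ := monotone_stabilizes_iff_noetherian.2 hN g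
  refine ⟨N, fun m hm => le_antisymm (fun r hr => ?_) (hf hm)⟩
  have hr' : π r ∈ g N := by
    rw [h m hm]
    exact Ideal.mem_map_of_mem π (TwoSidedIdeal.mem_asIdeal.2 hr)
  obtain ⟨r', hr', hrr'⟩ := (Ideal.mem_map_iff_of_surjective π hπ).1 hr'
  have := (f N).sub_mem (TwoSidedIdeal.mem_asIdeal.1 hr') (hf (Nat.zero_le N) ((hker _ _).1 hrr'))
  simpa using this

end OneSidedInverse

/-- Let `R` be generated by pairs `x i`, `y i` with `y i * x i = 1`, distinct pairs commuting.
Ascending chains of ideals stabilize if their members contain `1 - x i * y i` for all `i`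
outside a finite set. -/
theorem TwoSidedIdeal.monotone_stabilizes_of_pairs {K : Type*} [Field K] {ι : Type*} [Finite ι]
    (T : Finset ι) : ∀ {R : Type u} [Ring R] [Algebra K R] (x y : ι → R),
    (∀ i, y i * x i = 1) → (∀ i j, Commute (x i) (x j)) → (∀ i j, Commute (y i) (y j)) →
    (∀ i j, i ≠ j → Commute (x i) (y j)) →
    Algebra.adjoin K (Set.range x ∪ Set.range y) = ⊤ →
    ∀ f : ℕ → TwoSidedIdeal R, Monotone f → (∀ i ∉ T, 1 - x i * y i ∈ f 0) →
    ∃ N, ∀ m, N ≤ m → f m = f N := by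
  classical
  induction T using Finset.induction_on with
  | empty =>
    intro R _ _ x y hyx hxx hyy hxy hgen f hf hT
    have hxy' : ∀ i j, x i * y j - y j * x i ∈ f 0 := by
      intro i j
      by_cases h : i = j
      · subst h
        rw [hyx, ← neg_sub]
        exact (f 0).neg_mem (hT i (Finset.notMem_empty i))
      · rw [(hxy i j h).eq, sub_self]
        exact (f 0).zero_mem
    refine monotone_stabilizes_of_commute_mod
      ((Set.finite_range x).union (Set.finite_range y)) hgen hf ?_
    rintro _ (⟨i, rfl⟩ | ⟨i, rfl⟩) _ (⟨j, rfl⟩ | ⟨j, rfl⟩)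
    · rw [(hxx i j).eq, sub_self]
      exact (f 0).zero_mem
    · exact hxy' i j
    · rw [← neg_sub]
      exact (f 0).neg_mem (hxy' j i)
    · rw [(hyy i j).eq, sub_self]
      exact (f 0).zero_mem
  | insert i T _ ih =>
    intro R _ _ x y hyx hxx hyy hxy hgen f hf hT
    obtain ⟨N₁, hN₁⟩ := ih x y hyx hxx hyy hxy hgen
      (fun m => f m ⊔ span {1 - x i * y i}) (fun a b h => sup_le_sup_right (hf h) _) (by
        intro j hj
        by_cases h : j = i
        · subst h
          exact mem_sup_right (subset_span rfl)
        · exact mem_sup_left (hT j (by simp [h, hj])))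
    let x' : ι → R := Function.update x i 1
    let y' : ι → R := Function.update y i 1
    let A : Subalgebra K R := Algebra.adjoin K (Set.range x' ∪ Set.range y')
    have hx'i : x' i = 1 := Function.update_self ..
    have hy'i : y' i = 1 := Function.update_self ..
    have hx' : ∀ {j}, j ≠ i → x' j = x j := fun h => Function.update_of_ne h ..
    have hy' : ∀ {j}, j ≠ i → y' j = y j := fun h => Function.update_of_ne h ..
    have hx'A : ∀ j, x' j ∈ A := fun j => Algebra.subset_adjoin (Or.inl ⟨j, rfl⟩)
    have hy'A : ∀ j, y' j ∈ A := fun j => Algebra.subset_adjoin (Or.inr ⟨j, rfl⟩)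
    have hAx : ∀ a ∈ A, Commute a (x i) := by
      intro a ha
      refine (Algebra.commute_of_mem_adjoin_of_forall_mem_commute ha ?_).symm
      rintro _ (⟨j, rfl⟩ | ⟨j, rfl⟩) <;> by_cases h : j = i
      · rw [h, hx'i]; exact Commute.one_right _
      · rw [hx' h]; exact hxx i j
      · rw [h, hy'i]; exact Commute.one_right _
      · rw [hy' h]; exact hxy i j (Ne.symm h)
    have hAy : ∀ a ∈ A, Commute a (y i) := by
      intro a ha
      refine (Algebra.commute_of_mem_adjoin_of_forall_mem_commute ha ?_).symm
      rintro _ (⟨j, rfl⟩ | ⟨j, rfl⟩) <;> by_cases h : j = i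
      · rw [h, hx'i]; exact Commute.one_right _
      · rw [hx' h]; exact (hxy j i h).symm
      · rw [h, hy'i]; exact Commute.one_right _
      · rw [hy' h]; exact hyy i j
    have hgen' : Algebra.adjoin K ((A : Set R) ∪ {x i, y i}) = ⊤ := by
      rw [eq_top_iff, ← hgen]
      refine Algebra.adjoin_le ?_
      rintro _ (⟨j, rfl⟩ | ⟨j, rfl⟩) <;> by_cases h : j = i
      · exact Algebra.subset_adjoin (Or.inr (Or.inl (by rw [h])))
      · exact Algebra.subset_adjoin (Or.inl (hx' h ▸ hx'A j))
      · exact Algebra.subset_adjoin (Or.inr (Or.inr (by rw [h]; rfl)))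
      · exact Algebra.subset_adjoin (Or.inl (hy' h ▸ hy'A j))
    have hAe : ∀ a ∈ A, Commute a (1 - x i * y i) := fun a ha =>
      (Commute.one_right a).sub_right ((hAx a ha).mul_right (hAy a ha))
    let g : ℕ → TwoSidedIdeal A := fun m => .mk' {a | (a : R) * (1 - x i * y i) ∈ f m}
      (by simp)
      (fun {a b} ha hb => by simpa [add_mul] using (f m).add_mem ha hb)
      (fun {a} ha => by simpa using (f m).neg_mem ha)
      (fun {a b} hb => by simpa [mul_assoc] using (f m).mul_mem_left a _ hb)
      (fun {a b} ha => by
        have := (f m).mul_mem_right _ (b : R) ha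
        rwa [mul_assoc, ← (hAe b b.2).eq, ← mul_assoc] at this)
    have hg : ∀ m (a : A), a ∈ g m ↔ (a : R) * (1 - x i * y i) ∈ f m :=
      fun m a => mem_mk' _ _ _ _ _ _ _
    obtain ⟨N₂, hN₂⟩ := ih (R := A) (fun j => ⟨x' j, hx'A j⟩) (fun j => ⟨y' j, hy'A j⟩)
      (fun j => Subtype.ext <| show y' j * x' j = 1 by
        by_cases h : j = i
        · rw [h, hx'i, hy'i, one_mul]
        · rw [hx' h, hy' h, hyx])
      (fun j k => Subtype.ext <| show x' j * x' k = x' k * x' j by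
        by_cases h : j = i
        · rw [h, hx'i, one_mul, mul_one]
        · by_cases h' : k = i
          · rw [h', hx'i, one_mul, mul_one]
          · rw [hx' h, hx' h', (hxx j k).eq])
      (fun j k => Subtype.ext <| show y' j * y' k = y' k * y' j by
        by_cases h : j = i
        · rw [h, hy'i, one_mul, mul_one]
        · by_cases h' : k = i
          · rw [h', hy'i, one_mul, mul_one]
          · rw [hy' h, hy' h', (hyy j k).eq])
      (fun j k hjk => Subtype.ext <| show x' j * y' k = y' k * x' j by
        by_cases h : j = i
        · rw [h, hx'i, one_mul, mul_one]
        · by_cases h' : k = i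
          · rw [h', hy'i, one_mul, mul_one]
          · rw [hx' h, hy' h', (hxy j k hjk).eq])
      (by
        rw [← Algebra.adjoin_adjoin_coe_preimage (R := K) (s := Set.range x' ∪ Set.range y')]
        congr 1
        ext a
        simp [Subtype.ext_iff])
      g (fun a b h c hc => (hg b c).2 (hf h ((hg a c).1 hc)))
      (fun j hj => (hg _ _).2 <| show (1 - x' j * y' j) * (1 - x i * y i) ∈ f 0 by
        by_cases h : j = i
        · rw [h, hx'i, hy'i, one_mul, sub_self, zero_mul]
          exact (f 0).zero_mem
        · rw [hx' h, hy' h]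
          exact (f 0).mul_mem_right _ _ (hT j (by simp [h, hj])))
    refine ⟨max N₁ N₂, fun m hm => le_antisymm ?_ (hf hm)⟩
    refine le_of_le_sup_span_of_corner (hyx i) hAx hAy hgen' (hf hm) ?_ ?_
    · have h : f m ⊔ span {1 - x i * y i} = f (max N₁ N₂) ⊔ span {1 - x i * y i} :=
        (hN₁ m ((le_max_left _ _).trans hm)).trans (hN₁ _ (le_max_left _ _)).symm
      exact h ▸ le_sup_left
    · intro a ha h
      rw [← hg _ ⟨a, ha⟩] at h ⊢
      rwa [hN₂ _ (le_max_right _ _), ← hN₂ m ((le_max_right _ _).trans hm)]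

theorem Xop_monomial (K : Type u) [Field K] (n : ℕ) (i : Fin n) (α : Fin n →₀ ℕ) :
    Xop K n i (monomial α 1) = monomial (α + Finsupp.single i 1) 1 := by
  simp [Xop, X, monomial_mul, add_comm]

theorem Yop_monomial (K : Type u) [Field K] (n : ℕ) (i : Fin n) (α : Fin n →₀ ℕ) :
    Yop K n i (monomial α 1) =
      if α i = 0 then 0 else monomial (α - Finsupp.single i 1) (1 : K) := by
  have h : (monomial α 1 : PolyAlg K n) = basisMonomials (Fin n) K α := by simp
  rw [Yop, h, Module.Basis.constr_basis]

theorem Yop_mul_Xop (K : Type u) [Field K] (n : ℕ) (i : Fin n) : Yop K n i * Xop K n i = 1 := by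
  refine (basisMonomials (Fin n) K).ext fun α => ?_
  simp [Xop_monomial, Yop_monomial]

theorem commute_Xop_Xop (K : Type u) [Field K] (n : ℕ) (i j : Fin n) :
    Commute (Xop K n i) (Xop K n j) := by
  refine (basisMonomials (Fin n) K).ext fun α => ?_
  simp [Xop_monomial, add_right_comm]

theorem commute_Yop_Yop (K : Type u) [Field K] (n : ℕ) (i j : Fin n) :
    Commute (Yop K n i) (Yop K n j) := by
  by_cases h : i = j
  · rw [h]
  refine (basisMonomials (Fin n) K).ext fun α => ?_
  by_cases hi : α i = 0 <;> by_cases hj : α j = 0 <;>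
    simp [Yop_monomial, hi, hj, h, Ne.symm h, tsub_right_comm]

theorem commute_Xop_Yop (K : Type u) [Field K] (n : ℕ) (i j : Fin n) (h : i ≠ j) :
    Commute (Xop K n i) (Yop K n j) := by
  refine (basisMonomials (Fin n) K).ext fun α => ?_
  by_cases hj : α j = 0
  · simp [Xop_monomial, Yop_monomial, hj, Ne.symm h]
  · have : α + Finsupp.single i 1 - Finsupp.single j 1 =
        α - Finsupp.single j 1 + Finsupp.single i 1 := by
      refine (tsub_add_eq_add_tsub ?_).symm
      rw [Finsupp.single_le_iff]
      exact Nat.one_le_iff_ne_zero.2 hj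
    simp [Xop_monomial, Yop_monomial, hj, Ne.symm h, this]

/-- the set of two-sided ideals of `S_n` satisfies the ascending chain condition:
every ascending chain of two-sided ideals stabilizes. -/
theorem statement3 (K : Type u) [Field K] (n : ℕ) (hn : 0 < n) :
    ∀ f : ℕ → TwoSidedIdeal (SnAlg K n), Monotone f → ∃ N, ∀ m, N ≤ m → f m = f N := by
  intro f hf
  refine TwoSidedIdeal.monotone_stabilizes_of_pairs (K := K) Finset.univ (xS K n) (yS K n)
    (fun i => Subtype.ext (Yop_mul_Xop K n i))
    (fun i j => Subtype.ext (commute_Xop_Xop K n i j).eq)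
    (fun i j => Subtype.ext (commute_Yop_Yop K n i j).eq)
    (fun i j h => Subtype.ext (commute_Xop_Yop K n i j h).eq) ?_ f hf
    (fun i hi => absurd (Finset.mem_univ i) hi)
  have h := Algebra.adjoin_adjoin_coe_preimage (R := K)
    (s := Set.range (Xop K n) ∪ Set.range (Yop K n))
  refine eq_top_iff.2 (h.ge.trans (Algebra.adjoin_mono ?_))
  rintro a (⟨i, hi⟩ | ⟨i, hi⟩)
  · exact Or.inl ⟨i, Subtype.ext hi⟩
  · exact Or.inr ⟨i, Subtype.ext hi⟩
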